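/- Fix reals a < b, an integer p ≥ 1, and a continuous B : ℝ → ℝ^p with Gram matrix V := ∫_a^b B(t) B(t)ᵀ dt invertible. Let (Ω, 𝓕, P) be a probability space, S : Ω → Finset ℝ a random finite set with S(ω) ⊆ [a,b], Y : ℝ × Ω → ℝ jointly measurable and bounded, ρ : ℝ × Ω → (0,∞) measurable, and e : ℝ × Ω → ℝ jointly measurable and bounded. Define β := V⁻¹ ∫_a^b B(t) ( ∫_Ω Y(t,ω) dP(ω) ) dt and m(ω) := Σ_{u ∈ S(ω)} V⁻¹ B(u) ( Y(u,ω) − e(u,ω) ) / ρ(u,ω) + ∫_a^b V⁻¹ B(t) e(t,ω) dt. Assume: (i) the compensator (Campbell) identity E[ Σ_{u ∈ S} H(u,·) ] = E[ ∫_a^b H(t,·) ρ(t,·) dt ] holds for H(t,ω) := V⁻¹ B(t) ( Y(t,ω) − e(t,ω) ) / ρ(t,ω), with both sides finite; and (ii) for every t ∈ [a,b], ∫_Ω e(t,ω) dP(ω) = ∫_Ω Y(t,ω) dP(ω). Then E[m] = β; equivalently, the influence function φ(O;P) = m(O;P) − β of Corollary 1 has mean zero. -/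

import Mathlib

open MeasureTheory intervalIntegral Matrix Function

/-- A bounded jointly measurable scalar process times a continuous path is integrable on
`(a, b] × Ω`. -/
lemma integrable_prod_smul_of_bounded {Ω E : Type*} [MeasurableSpace Ω] [NormedAddCommGroup E]
    [NormedSpace ℝ E] (P : Measure Ω) [IsFiniteMeasure P] (a b : ℝ)
    {f : ℝ → Ω → ℝ} (hf : Measurable (uncurry f)) (hbd : ∃ C, ∀ t ω, |f t ω| ≤ C)
    {g : ℝ → E} (hg : Continuous g) :
    Integrable (uncurry fun t ω => f t ω • g t)
      ((volume.restrict (Set.Ioc a b)).prod P) := by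
  obtain ⟨C, hC⟩ := hbd
  have hgi : Integrable g (volume.restrict (Set.Ioc a b)) := hg.integrableOn_Ioc
  have hgp : Integrable (fun z : ℝ × Ω => g z.1) ((volume.restrict (Set.Ioc a b)).prod P) :=
    hgi.comp_fst P
  exact hgp.bdd_smul C hf.aestronglyMeasurable (Filter.Eventually.of_forall fun z => hC z.1 z.2)

/-- Fubini for a bounded jointly measurable scalar process times a continuous path. -/
lemma integral_intervalIntegral_smul_of_bounded {Ω E : Type*} [MeasurableSpace Ω]
    [NormedAddCommGroup E] [NormedSpace ℝ E] [CompleteSpace E] (P : Measure Ω)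
    [IsFiniteMeasure P] {a b : ℝ} (hab : a ≤ b)
    {f : ℝ → Ω → ℝ} (hf : Measurable (uncurry f)) (hbd : ∃ C, ∀ t ω, |f t ω| ≤ C)
    {g : ℝ → E} (hg : Continuous g) :
    Integrable (fun ω => ∫ t in a..b, f t ω • g t) P ∧
      ∫ ω, (∫ t in a..b, f t ω • g t) ∂P = ∫ t in a..b, (∫ ω, f t ω ∂P) • g t := by
  have hint := integrable_prod_smul_of_bounded P a b hf hbd hg
  simp only [intervalIntegral.integral_of_le hab]
  refine ⟨hint.integral_prod_right, ?_⟩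
  rw [← integral_integral_swap hint]
  simp only [_root_.integral_smul_const]

/-- A bounded section of a jointly measurable process is integrable. -/
lemma integrable_section_of_bounded {Ω : Type*} [MeasurableSpace Ω] (P : Measure Ω)
    [IsFiniteMeasure P] {f : ℝ → Ω → ℝ} (hf : Measurable (uncurry f))
    (hbd : ∃ C, ∀ t ω, |f t ω| ≤ C) (t : ℝ) : Integrable (f t) P := by
  obtain ⟨C, hC⟩ := hbd
  exact Integrable.of_bound (hf.comp measurable_prodMk_left).aestronglyMeasurable C
    (Filter.Eventually.of_forall (hC t))

/-- Mean-zero property of the identity-link influence function of Corollary 1: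
with `β = V⁻¹ ∫_a^b B(t) E[Y(t)] dt` and
`m(ω) = Σ_{u∈S(ω)} V⁻¹B(u)(Y(u,ω)−e(u,ω))/ρ(u,ω) + ∫_a^b V⁻¹B(t) e(t,ω) dt`,
the Campbell identity and the law of total expectation give `E[m] = β`. -/
theorem stmt7 (a b : ℝ) (hab : a < b) (p : ℕ) (hp : 1 ≤ p)
    (B : ℝ → Fin p → ℝ) (hB : Continuous B)
    (V : Matrix (Fin p) (Fin p) ℝ)
    (hV : V = Matrix.of fun i j => ∫ t in a..b, B t i * B t j)
    (hVinv : IsUnit V)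
    (Ω : Type*) [MeasurableSpace Ω] (P : Measure Ω) [IsProbabilityMeasure P]
    (S : Ω → Finset ℝ) (hS : ∀ ω, ∀ u ∈ S ω, u ∈ Set.Icc a b)
    (Y : ℝ → Ω → ℝ) (hYmeas : Measurable (uncurry Y))
    (hYbd : ∃ C, ∀ t ω, |Y t ω| ≤ C)
    (ρ : ℝ → Ω → ℝ) (hρmeas : Measurable (uncurry ρ)) (hρpos : ∀ t ω, 0 < ρ t ω)
    (e : ℝ → Ω → ℝ) (hemeas : Measurable (uncurry e))
    (hebd : ∃ C, ∀ t ω, |e t ω| ≤ C)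
    (β : Fin p → ℝ)
    (hβ : β = ∫ t in a..b, (∫ ω, Y t ω ∂P) • (V⁻¹ *ᵥ B t))
    (m : Ω → Fin p → ℝ)
    (hm : m = fun ω => (∑ u ∈ S ω, ((Y u ω - e u ω) / ρ u ω) • (V⁻¹ *ᵥ B u))
      + ∫ t in a..b, e t ω • (V⁻¹ *ᵥ B t))
    (H : ℝ → Ω → Fin p → ℝ)
    (hH : H = fun t ω => ((Y t ω - e t ω) / ρ t ω) • (V⁻¹ *ᵥ B t))
    -- (i) compensator (Campbell) identity, with both sides finite
    (hIntSum : Integrable (fun ω => ∑ u ∈ S ω, H u ω) P)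
    (hIntComp : Integrable (fun ω => ∫ t in a..b, ρ t ω • H t ω) P)
    (hCampbell : (∫ ω, (∑ u ∈ S ω, H u ω) ∂P)
      = ∫ ω, (∫ t in a..b, ρ t ω • H t ω) ∂P)
    -- (ii) law of total expectation for the conditional mean `e`
    (hTotal : ∀ t ∈ Set.Icc a b, (∫ ω, e t ω ∂P) = ∫ ω, Y t ω ∂P) :
    (∫ ω, m ω ∂P) = β := by
  subst hβ hm hH
  have hg : Continuous fun t => V⁻¹ *ᵥ B t := continuous_const.matrix_mulVec hB
  have hdiffbd : ∃ C, ∀ t ω, |Y t ω - e t ω| ≤ C := by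
    obtain ⟨C, hC⟩ := hYbd
    obtain ⟨D, hD⟩ := hebd
    exact ⟨C + D, fun t ω => (abs_sub _ _).trans (add_le_add (hC t ω) (hD t ω))⟩
  obtain ⟨he, he'⟩ := integral_intervalIntegral_smul_of_bounded P hab.le hemeas hebd hg
  obtain ⟨-, hd'⟩ := integral_intervalIntegral_smul_of_bounded P hab.le
    (f := fun t ω => Y t ω - e t ω) (hYmeas.sub hemeas) hdiffbd hg
  have hcancel : ∀ t ω, ρ t ω • ((Y t ω - e t ω) / ρ t ω) • (V⁻¹ *ᵥ B t)
      = (Y t ω - e t ω) • (V⁻¹ *ᵥ B t) := fun t ω => by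
    rw [smul_smul, mul_div_cancel₀ _ (hρpos t ω).ne']
  have hsum : ∫ ω, (∑ u ∈ S ω, ((Y u ω - e u ω) / ρ u ω) • (V⁻¹ *ᵥ B u)) ∂P = 0 := by
    rw [hCampbell]
    simp only [hcancel]
    rw [hd', ← intervalIntegral.integral_zero (a := a) (b := b) (μ := volume)]
    refine intervalIntegral.integral_congr fun t ht => ?_
    rw [Set.uIcc_of_le hab.le] at ht
    rw [integral_sub (integrable_section_of_bounded P hYmeas hYbd t)
      (integrable_section_of_bounded P hemeas hebd t), hTotal t ht, sub_self, zero_smul]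
  rw [integral_add hIntSum he, hsum, zero_add, he']
  refine intervalIntegral.integral_congr fun t ht => ?_
  rw [Set.uIcc_of_le hab.le] at ht
  simp only [hTotal t ht]
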